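/- arXiv:1710.05674 — 5 statements merged into one kernel-verified Lean document; each statement's English description precedes it below -/
import Mathlib

section
/- Let V be a finite-dimensional real symplectic vector space of dimension n ≥ 6 with symplectic form Ω. Let A : V × V → V be an ℝ-bilinear map such that (i) A(x,y) = −A(y,x) for all x,y ∈ V, and (ii) for every x ∈ V the endomorphism y ↦ A(x,y) is conformally symplectic. Then there exists a unique vector w ∈ V such that A(x,y) = Ω(w,x)·y − Ω(w,y)·x − Ω(x,y)·w for all x,y ∈ V. Conversely, for every w ∈ V this formula defines a bilinear map satisfying (i) and (ii), with Ω(A(x,u),v) + Ω(u,A(x,v)) = 2Ω(w,x)·Ω(u,v) for all x,u,v. (This is the pointwise algebraic core of Theorem 1.1, first part: two ACS-connections share the same geodesics including parametrization iff they differ by a one-form s_a via s_a δ_b{}^d − s_b δ_a{}^d − J_{ab} s^d.) -/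
/-- An endomorphism `A` of `V` is conformally symplectic with respect to the
symplectic form `Ω` if `Ω(Ax,y) + Ω(x,Ay) = c·Ω(x,y)` for some constant `c`. -/
def IsConformallySymplectic {V : Type*} [AddCommGroup V] [Module ℝ V]
    (Ω : V →ₗ[ℝ] V →ₗ[ℝ] ℝ) (A : V →ₗ[ℝ] V) : Prop :=
  ∃ c : ℝ, ∀ x y : V, Ω (A x) y + Ω x (A y) = c * Ω x y

/-- Pointwise algebraic core of Theorem 1.1 (first part): an antisymmetric bilinear map
`A : V × V → V` whose partial maps are conformally symplectic is of the form
`A(x,y) = Ω(w,x)·y − Ω(w,y)·x − Ω(x,y)·w` for a unique `w`; conversely, for every `w`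
this formula is antisymmetric and conformally symplectic in the second slot, with
`Ω(A(x,u),v) + Ω(u,A(x,v)) = 2Ω(w,x)Ω(u,v)`. -/
theorem stmt0 {V : Type*} [AddCommGroup V] [Module ℝ V] [FiniteDimensional ℝ V]
    (Ω : V →ₗ[ℝ] V →ₗ[ℝ] ℝ)
    (halt : ∀ x : V, Ω x x = 0)
    (hnd : ∀ x : V, (∀ y : V, Ω x y = 0) → x = 0)
    (hdim : 6 ≤ Module.finrank ℝ V) :
    (∀ A : V →ₗ[ℝ] V →ₗ[ℝ] V,
      (∀ x y : V, A x y = - A y x) →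
      (∀ x : V, IsConformallySymplectic Ω (A x)) →
      ∃! w : V, ∀ x y : V, A x y = Ω w x • y - Ω w y • x - Ω x y • w) ∧
    (∀ w x y u v : V,
      (Ω w x • y - Ω w y • x - Ω x y • w : V)
        = -(Ω w y • x - Ω w x • y - Ω y x • w) ∧
      Ω (Ω w x • u - Ω w u • x - Ω x u • w) v
          + Ω u (Ω w x • v - Ω w v • x - Ω x v • w)
        = 2 * Ω w x * Ω u v) := by
  have hsk : ∀ x y : V, Ω x y = - Ω y x := by
    intro x y
    have h := halt (x + y)
    simp only [map_add, LinearMap.add_apply, halt] at h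
    linarith
  have hconv : ∀ w x u v : V, Ω (Ω w x • u - Ω w u • x - Ω x u • w) v
          + Ω u (Ω w x • v - Ω w v • x - Ω x v • w)
        = 2 * Ω w x * Ω u v := by
    intro w x u v
    simp only [map_sub, map_smul, LinearMap.sub_apply, LinearMap.smul_apply, smul_eq_mul]
    rw [hsk u x, hsk u w]
    ring
  refine ⟨?_, ?_⟩
  · intro A hA hC
    obtain ⟨e, f, hef⟩ : ∃ e f : V, Ω e f ≠ 0 := by
      by_contra! hcon
      have h0 : ∀ x : V, x = 0 := fun x => hnd x (hcon x)
      haveI : Subsingleton V := ⟨fun a b => by rw [h0 a, h0 b]⟩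
      have := Module.finrank_zero_of_subsingleton (R := ℝ) (M := V)
      omega
    choose c hc using hC
    -- the conformal factor is linear
    let cl : V →ₗ[ℝ] ℝ :=
      { toFun := fun x => (Ω (A x e) f + Ω e (A x f)) / (2 * Ω e f)
        map_add' := by
          intro x y
          simp only [map_add, LinearMap.add_apply]
          ring
        map_smul' := by
          intro r x
          simp only [map_smul, LinearMap.smul_apply, smul_eq_mul, RingHom.id_apply]
          ring }
    have hinj : Function.Injective Ω := by
      rw [← LinearMap.ker_eq_bot, LinearMap.ker_eq_bot']
      intro m hm
      exact hnd m fun y => by rw [hm]; rfl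
    have hsurj : Function.Surjective Ω :=
      (LinearMap.injective_iff_surjective_of_finrank_eq_finrank
        (Subspace.dual_finrank_eq (K := ℝ) (V := V)).symm).1 hinj
    obtain ⟨w, hw⟩ := hsurj cl
    have hcw : ∀ x, c x = 2 * Ω w x := by
      intro x
      have h1 : Ω w x = (Ω (A x e) f + Ω e (A x f)) / (2 * Ω e f) := by rw [hw]; rfl
      rw [h1, hc x e f]
      field_simp
    have key : ∀ x u v : V, Ω (A x u) v - Ω (A x v) u = 2 * Ω w x * Ω u v := by
      intro x u v
      rw [← hcw, ← hc x u v, hsk u (A x v)]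
      ring
    have anti : ∀ x u v : V, Ω (A x u) v = - Ω (A u x) v := by
      intro x u v
      rw [hA x u, map_neg, LinearMap.neg_apply]
    refine ⟨w, ?_, ?_⟩
    · intro x u
      rw [← sub_eq_zero]
      apply hnd
      intro v
      simp only [map_sub, map_smul, LinearMap.sub_apply, LinearMap.smul_apply, smul_eq_mul]
      have k1 := key x u v
      have k2 := key u v x
      have k3 := key v x u
      rw [hsk v x] at k2
      have a1 := anti x u v
      have a2 := anti u v x
      have a3 := anti v x u
      linarith
    · intro w' hw'
      have h2 : ∀ x, Ω w' x = Ω w x := by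
        intro x
        have h := hconv w' x e f
        rw [← hw' x e, ← hw' x f, hc, hcw] at h
        have := mul_right_cancel₀ hef h
        linarith
      exact hinj (LinearMap.ext h2)
  · intro w x y u v
    refine ⟨?_, hconv w x u v⟩
    rw [hsk y x, neg_smul]
    abel
end

section
/- Let V be a finite-dimensional real symplectic vector space of dimension n ≥ 6 with symplectic form Ω. Let A : V × V → V be ℝ-bilinear such that for every x ∈ V the endomorphism y ↦ A(x,y) is conformally symplectic. Then the following are equivalent: (a) there exists Υ ∈ V* with A(x,y) + A(y,x) = Υ(x)·y + Υ(y)·x for all x,y ∈ V; (b) there exist b, w ∈ V such that A(x,y) = (Ω(b,x)+Ω(w,x))·y + (Ω(b,y)−Ω(w,y))·x + Ω(x,y)·(b − w) for all x,y ∈ V. Moreover, in case (b) the vectors b and w are uniquely determined by A, and the functional Υ in (a) equals 2Ω(b,·). (This is the pointwise algebraic core of the second part of Theorem 1.1 and of Corollary 1.3: two ACS-connections share the same geodesics up to parametrization iff they differ by (β_a+s_a)δ_b{}^d + (β_b−s_b)δ_a{}^d + J_{ab}(β^d−s^d) for one-forms β, s.) -/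
/-- Pointwise algebraic core of Theorem 1.1 (second part) and Corollary 1.3:
for a bilinear map `A` with conformally symplectic partial maps, the symmetric part of `A`
is of projective form `Υ(x)·y + Υ(y)·x` if and only if
`A(x,y) = (Ω(b,x)+Ω(w,x))·y + (Ω(b,y)−Ω(w,y))·x + Ω(x,y)·(b−w)` for some `b,w ∈ V`;
moreover `b`, `w` are unique and `Υ = 2Ω(b,·)`. -/
theorem stmt1 {V : Type*} [AddCommGroup V] [Module ℝ V] [FiniteDimensional ℝ V]
    (Ω : V →ₗ[ℝ] V →ₗ[ℝ] ℝ)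
    (halt : ∀ x : V, Ω x x = 0)
    (hnd : ∀ x : V, (∀ y : V, Ω x y = 0) → x = 0)
    (hdim : 6 ≤ Module.finrank ℝ V)
    (A : V →ₗ[ℝ] V →ₗ[ℝ] V)
    (hcsp : ∀ x : V, IsConformallySymplectic Ω (A x)) :
    ((∃ Υ : Module.Dual ℝ V, ∀ x y : V, A x y + A y x = Υ x • y + Υ y • x) ↔
      (∃ b w : V, ∀ x y : V,
        A x y = (Ω b x + Ω w x) • y + (Ω b y - Ω w y) • x + Ω x y • (b - w))) ∧
    (∀ b w b' w' : V,
      (∀ x y : V, A x y = (Ω b x + Ω w x) • y + (Ω b y - Ω w y) • x + Ω x y • (b - w)) →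
      (∀ x y : V, A x y = (Ω b' x + Ω w' x) • y + (Ω b' y - Ω w' y) • x + Ω x y • (b' - w')) →
      b = b' ∧ w = w') ∧
    (∀ (Υ : Module.Dual ℝ V) (b w : V),
      (∀ x y : V, A x y + A y x = Υ x • y + Υ y • x) →
      (∀ x y : V, A x y = (Ω b x + Ω w x) • y + (Ω b y - Ω w y) • x + Ω x y • (b - w)) →
      ∀ x : V, Υ x = 2 * Ω b x) := by
  have hskew : ∀ x y : V, Ω x y = - Ω y x := by
    intro x y
    have h := halt (x + y)
    simp only [map_add, LinearMap.add_apply, halt] at h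
    linarith
  have hsub : ∀ u v z : V, Ω (u - v) z = Ω u z - Ω v z := by
    intro u v z
    simp
  have hinj : Function.Injective Ω := by
    rw [injective_iff_map_eq_zero]
    intro x hx
    exact hnd x (fun y => by rw [hx]; rfl)
  have hsurj : Function.Surjective Ω :=
    (LinearMap.injective_iff_surjective_of_finrank_eq_finrank
      (f := (Ω : V →ₗ[ℝ] Module.Dual ℝ V)) Subspace.dual_finrank_eq.symm).1 hinj
  have hext : ∀ u v : V, (∀ z, Ω u z = Ω v z) → u = v :=
    fun u v h => hinj (LinearMap.ext h)
  have h3 : ∀ (Υ : Module.Dual ℝ V) (b w : V),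
      (∀ x y : V, A x y + A y x = Υ x • y + Υ y • x) →
      (∀ x y : V, A x y = (Ω b x + Ω w x) • y + (Ω b y - Ω w y) • x + Ω x y • (b - w)) →
      ∀ x : V, Υ x = 2 * Ω b x := by
    intro Υ b w h1 h2 x
    by_cases hx : x = 0
    · simp [hx]
    have h := h1 x x
    rw [h2 x x, halt] at h
    have h' : (Υ x - 2 * Ω b x) • x = 0 := by
      have h4 : (2 : ℝ) • ((Υ x - 2 * Ω b x) • x) = 0 := by
        rw [← sub_eq_zero] at h
        linear_combination (norm := module) (-1 : ℝ) • h
      exact (smul_eq_zero.1 h4).resolve_left two_ne_zero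
    have := (smul_eq_zero.1 h').resolve_right hx
    linarith
  have hba : ∀ b w : V,
      (∀ x y : V, A x y = (Ω b x + Ω w x) • y + (Ω b y - Ω w y) • x + Ω x y • (b - w)) →
      ∀ x y : V, A x y + A y x = ((2 : ℝ) • Ω b) x • y + ((2 : ℝ) • Ω b) y • x := by
    intro b w h x y
    rw [h x y, h y x, hskew y x]
    simp only [LinearMap.smul_apply, smul_eq_mul]
    module
  refine ⟨⟨?_, ?_⟩, ?_, h3⟩
  · rintro ⟨Υ, hΥ⟩
    have hne : ∃ y z : V, Ω y z = 1 := by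
      have : Nontrivial V := Module.nontrivial_of_finrank_pos (R := ℝ) (by omega)
      obtain ⟨y, hy⟩ := exists_ne (0 : V)
      have : ∃ z, Ω y z ≠ 0 := by
        by_contra hcon
        push Not at hcon
        exact hy (hnd y hcon)
      obtain ⟨z, hz⟩ := this
      exact ⟨y, (Ω y z)⁻¹ • z, by simp [hz]⟩
    obtain ⟨p, q, hpq⟩ := hne
    have hc : ∃ c : Module.Dual ℝ V, ∀ x y z : V,
        Ω (A x y) z + Ω y (A x z) = c x * Ω y z := by
      refine ⟨(Ω.flip q) ∘ₗ (A.flip p) + (Ω p) ∘ₗ (A.flip q), ?_⟩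
      intro x y z
      obtain ⟨c, hc⟩ := hcsp x
      have h1 := hc p q
      rw [hpq, mul_one] at h1
      rw [hc y z, ← h1]
      simp
    obtain ⟨c, hc⟩ := hc
    obtain ⟨b, hb⟩ := hsurj ((1 / 2 : ℝ) • Υ)
    obtain ⟨w, hw⟩ := hsurj ((1 / 2 : ℝ) • c - (1 / 2 : ℝ) • Υ)
    refine ⟨b, w, fun x y => hext _ _ fun z => ?_⟩
    have hcs : ∀ x y z : V, Ω (A x y) z - Ω (A x z) y = c x * Ω y z := by
      intro x y z
      rw [← hc x y z, hskew y (A x z)]; ring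
    have hs : ∀ x y z : V, Ω (A x y) z + Ω (A y x) z = Υ x * Ω y z + Υ y * Ω x z := by
      intro x y z
      have := congrArg (fun v => Ω v z) (hΥ x y)
      simpa using this
    have hbz : ∀ v, Ω b v = 1 / 2 * Υ v := fun v => by rw [hb]; simp
    have hwz : ∀ v, Ω w v = 1 / 2 * c v - 1 / 2 * Υ v := fun v => by rw [hw]; simp
    simp only [map_add, map_sub, map_smul, LinearMap.add_apply, LinearMap.sub_apply,
      LinearMap.smul_apply, smul_eq_mul, hbz, hwz]
    have e1 := hs x y z
    have e2 := hcs y x z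
    have e3 := hs y z x
    have e4 := hcs z y x
    have e5 := hs z x y
    have e6 := hcs x y z
    rw [hskew z x, hskew y x] at e3
    rw [hskew y x] at e4
    rw [hskew z y] at e5
    linear_combination (1 / 2 : ℝ) * (e1 - e2 - e3 + e4 + e5 + e6)
  · rintro ⟨b, w, h⟩
    exact ⟨(2 : ℝ) • Ω b, hba b w h⟩
  · intro b w b' w' h h'
    have hbb : b = b' := by
      apply hext
      intro z
      have := h3 _ b' w' (hba b w h) h' z
      simp only [LinearMap.smul_apply, smul_eq_mul] at this
      linarith
    subst hbb
    refine ⟨rfl, ?_⟩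
    by_contra hne
    have hd : w - w' ≠ 0 := sub_ne_zero.2 hne
    apply hd
    apply hnd
    intro y
    have e := (h (w - w') y).symm.trans (h' (w - w') y)
    have e0 : Ω w (w - w') = Ω w' (w - w') := by
      have := halt (w - w')
      rw [hsub] at this
      linarith
    rw [e0] at e
    have e1 : (2 * Ω (w - w') y) • (w - w') = 0 := by
      rw [hsub w w' y] at e ⊢
      rw [← sub_eq_zero] at e
      linear_combination (norm := module) (-1 : ℝ) • e
    have := (smul_eq_zero.1 e1).resolve_right hd
    linarith
end

section
/- Let V be a finite-dimensional real symplectic vector space of dimension n ≥ 6 with symplectic form Ω. Then every trilinear form T : V × V × V → ℝ which is antisymmetric in its last two arguments (T(a,b,c) = −T(a,c,b)) admits a unique decomposition: there exist unique α, β ∈ V*, a unique totally antisymmetric trilinear form S with vanishing Ω-trace, and a unique trilinear form H, antisymmetric in its first two arguments, with vanishing cyclic sum H(x,y,z)+H(y,z,x)+H(z,x,y) = 0 and vanishing Ω-trace, such that T(a,b,c) = 2α(a)Ω(b,c) + Ω(a,b)β(c) − Ω(a,c)β(b) − H(b,c,a) + 2S(b,c,a) for all a,b,c ∈ V. (This is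 the decomposition of D_a J_{bc} into irreducible components used throughout Section 2 of the paper.) -/
/-- The Ω-trace of a trilinear form `F` (contraction of the first and third arguments
via the symplectic form, encoded by the isomorphism `φ : V ≃ V*`): the functional
`y ↦ tr(v ↦ φ⁻¹(F(v,y,·)))`. -/
noncomputable def omegaTrace {V : Type*} [AddCommGroup V] [Module ℝ V]
    (φ : V ≃ₗ[ℝ] Module.Dual ℝ V) (F : V →ₗ[ℝ] V →ₗ[ℝ] V →ₗ[ℝ] ℝ) (y : V) : ℝ :=
  LinearMap.trace ℝ V (φ.symm.toLinearMap ∘ₗ F.flip y)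

namespace Stmt2Aux

variable {V : Type*} [AddCommGroup V] [Module ℝ V]

/-- Rotation of the arguments of a trilinear form. -/
noncomputable def rot (F : V →ₗ[ℝ] V →ₗ[ℝ] V →ₗ[ℝ] ℝ) : V →ₗ[ℝ] V →ₗ[ℝ] V →ₗ[ℝ] ℝ :=
  LinearMap.mk₂ ℝ (fun x y => (F.flip x).flip y)
    (by intros; ext; simp) (by intros; ext; simp) (by intros; ext; simp) (by intros; ext; simp)

@[simp] lemma rot_apply (F : V →ₗ[ℝ] V →ₗ[ℝ] V →ₗ[ℝ] ℝ) (x y z : V) :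
    rot F x y z = F z x y := rfl

/-- The product of a linear and a bilinear form. -/
noncomputable def el (Ω : V →ₗ[ℝ] V →ₗ[ℝ] ℝ) (γ : Module.Dual ℝ V) :
    V →ₗ[ℝ] V →ₗ[ℝ] V →ₗ[ℝ] ℝ := LinearMap.smulRight γ Ω

@[simp] lemma el_apply (Ω : V →ₗ[ℝ] V →ₗ[ℝ] ℝ) (γ : Module.Dual ℝ V) (x y z : V) :
    el Ω γ x y z = γ x * Ω y z := by simp [el]

lemma tr_add (φ : V ≃ₗ[ℝ] Module.Dual ℝ V) (F G : V →ₗ[ℝ] V →ₗ[ℝ] V →ₗ[ℝ] ℝ) (y : V) :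
    omegaTrace φ (F + G) y = omegaTrace φ F y + omegaTrace φ G y := by
  unfold omegaTrace
  rw [← map_add]; congr 1; ext; simp

lemma tr_smul (φ : V ≃ₗ[ℝ] Module.Dual ℝ V) (r : ℝ) (F : V →ₗ[ℝ] V →ₗ[ℝ] V →ₗ[ℝ] ℝ) (y : V) :
    omegaTrace φ (r • F) y = r * omegaTrace φ F y := by
  unfold omegaTrace
  rw [← smul_eq_mul, ← map_smul]; congr 1; ext; simp

/-- The trace as a functional. -/
noncomputable def trL (φ : V ≃ₗ[ℝ] Module.Dual ℝ V) (F : V →ₗ[ℝ] V →ₗ[ℝ] V →ₗ[ℝ] ℝ) :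
    Module.Dual ℝ V where
  toFun := omegaTrace φ F
  map_add' x y := by
    unfold omegaTrace
    rw [← map_add]; congr 1; ext; simp
  map_smul' r x := by
    unfold omegaTrace
    rw [RingHom.id_apply, ← map_smul]; congr 1; ext; simp

@[simp] lemma trL_apply (φ : V ≃ₗ[ℝ] Module.Dual ℝ V) (F : V →ₗ[ℝ] V →ₗ[ℝ] V →ₗ[ℝ] ℝ) (y : V) :
    trL φ F y = omegaTrace φ F y := rfl

lemma tr_el [FiniteDimensional ℝ V] (Ω : V →ₗ[ℝ] V →ₗ[ℝ] ℝ)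
    (φ : V ≃ₗ[ℝ] Module.Dual ℝ V) (hφ : ∀ w v : V, φ w v = Ω w v)
    (γ : Module.Dual ℝ V) (y : V) : omegaTrace φ (el Ω γ) y = γ y := by
  have : φ.symm.toLinearMap ∘ₗ (el Ω γ).flip y = LinearMap.smulRight γ y := by
    ext v
    simp only [LinearMap.comp_apply, LinearEquiv.coe_coe, LinearMap.smulRight_apply]
    rw [LinearEquiv.symm_apply_eq]
    ext w
    simp [hφ]
  unfold omegaTrace
  rw [this, LinearMap.trace_smulRight]

lemma tr_rot_el [FiniteDimensional ℝ V] (Ω : V →ₗ[ℝ] V →ₗ[ℝ] ℝ)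
    (φ : V ≃ₗ[ℝ] Module.Dual ℝ V) (hφ : ∀ w v : V, φ w v = Ω w v)
    (γ : Module.Dual ℝ V) (y : V) : omegaTrace φ (rot (el Ω γ)) y = γ y := by
  have : φ.symm.toLinearMap ∘ₗ (rot (el Ω γ)).flip y =
      LinearMap.smulRight (Ω.flip y) (φ.symm γ) := by
    ext v
    simp only [LinearMap.comp_apply, LinearEquiv.coe_coe, LinearMap.smulRight_apply]
    rw [LinearEquiv.symm_apply_eq]
    ext w
    simp [mul_comm]
  unfold omegaTrace
  rw [this, LinearMap.trace_smulRight, LinearMap.flip_apply, ← hφ]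
  simp

lemma tr_rot_rot_el [FiniteDimensional ℝ V] (Ω : V →ₗ[ℝ] V →ₗ[ℝ] ℝ)
    (φ : V ≃ₗ[ℝ] Module.Dual ℝ V) (hφ : ∀ w v : V, φ w v = Ω w v)
    (γ : Module.Dual ℝ V) (y : V) (hs : ∀ x y : V, Ω x y = - Ω y x) :
    omegaTrace φ (rot (rot (el Ω γ))) y = - (Module.finrank ℝ V : ℝ) * γ y := by
  have : φ.symm.toLinearMap ∘ₗ (rot (rot (el Ω γ))).flip y = (- γ y) • LinearMap.id := by
    ext v
    simp only [LinearMap.comp_apply, LinearEquiv.coe_coe]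
    rw [LinearEquiv.symm_apply_eq]
    ext w
    simp [hφ, hs w v]
  unfold omegaTrace
  rw [this, map_smul, LinearMap.trace_id, smul_eq_mul]
  ring

end Stmt2Aux

open Stmt2Aux

/-- The decomposition of trilinear forms antisymmetric in the last two arguments used in
Section 2 of the paper: `T(a,b,c) = 2α(a)Ω(b,c) + Ω(a,b)β(c) − Ω(a,c)β(b) − H(b,c,a) + 2S(b,c,a)`
with unique `α, β ∈ V*`, `S` totally antisymmetric with vanishing Ω-trace, and `H`
antisymmetric in the first two arguments with vanishing cyclic sum and vanishing Ω-trace. -/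
theorem stmt2 {V : Type*} [AddCommGroup V] [Module ℝ V] [FiniteDimensional ℝ V]
    (Ω : V →ₗ[ℝ] V →ₗ[ℝ] ℝ)
    (halt : ∀ x : V, Ω x x = 0)
    (hnd : ∀ x : V, (∀ y : V, Ω x y = 0) → x = 0)
    (φ : V ≃ₗ[ℝ] Module.Dual ℝ V) (hφ : ∀ w v : V, φ w v = Ω w v)
    (hdim : 6 ≤ Module.finrank ℝ V)
    (T : V →ₗ[ℝ] V →ₗ[ℝ] V →ₗ[ℝ] ℝ)
    (hT : ∀ a b c : V, T a b c = - T a c b) :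
    ∃! p : Module.Dual ℝ V × Module.Dual ℝ V ×
        (V →ₗ[ℝ] V →ₗ[ℝ] V →ₗ[ℝ] ℝ) × (V →ₗ[ℝ] V →ₗ[ℝ] V →ₗ[ℝ] ℝ),
      (∀ x y z : V, p.2.2.1 x y z = - p.2.2.1 y x z) ∧
      (∀ x y z : V, p.2.2.1 x y z + p.2.2.1 y z x + p.2.2.1 z x y = 0) ∧
      (∀ y : V, omegaTrace φ p.2.2.1 y = 0) ∧
      (∀ x y z : V, p.2.2.2 x y z = - p.2.2.2 y x z) ∧
      (∀ x y z : V, p.2.2.2 x y z = - p.2.2.2 x z y) ∧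
      (∀ y : V, omegaTrace φ p.2.2.2 y = 0) ∧
      (∀ a b c : V, T a b c =
        2 * p.1 a * Ω b c + Ω a b * p.2.1 c - Ω a c * p.2.1 b
          - p.2.2.1 b c a + 2 * p.2.2.2 b c a) := by
  have hs : ∀ x y : V, Ω x y = - Ω y x := by
    intro x y
    have h := halt (x + y)
    simp only [map_add, LinearMap.add_apply, halt] at h
    linarith
  have hn : (6 : ℝ) ≤ (Module.finrank ℝ V : ℝ) := by exact_mod_cast hdim
  set n : ℝ := (Module.finrank ℝ V : ℝ) with hndef
  have h2 : n - 2 ≠ 0 := by intro h; linarith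
  have h1 : n + 1 ≠ 0 := by intro h; linarith
  have e0 := fun γ y => tr_el Ω φ hφ γ y
  have e1 := fun γ y => tr_rot_el Ω φ hφ γ y
  have e2 : ∀ (γ : Module.Dual ℝ V) (y : V), omegaTrace φ (rot (rot (el Ω γ))) y = -n * γ y :=
    fun γ y => tr_rot_rot_el Ω φ hφ γ y hs
  let C : V →ₗ[ℝ] V →ₗ[ℝ] V →ₗ[ℝ] ℝ := T + rot T + rot (rot T)
  let σ : Module.Dual ℝ V := (-(1 / (2 * (n - 2)))) • trL φ C
  let β : Module.Dual ℝ V := (1 / (n + 1)) • (2 • σ - trL φ (rot T))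
  let α : Module.Dual ℝ V := σ - β
  let S : V →ₗ[ℝ] V →ₗ[ℝ] V →ₗ[ℝ] ℝ :=
    (1 / 6 : ℝ) • (C + (-2 : ℝ) • (el Ω σ + rot (el Ω σ) + rot (rot (el Ω σ))))
  let H : V →ₗ[ℝ] V →ₗ[ℝ] V →ₗ[ℝ] ℝ :=
    (2 : ℝ) • rot (el Ω α) + rot (rot (el Ω β)) + el Ω β + (2 : ℝ) • S + (-1 : ℝ) • rot T
  have hC : ∀ x y z, C x y z = T x y z + T z x y + T y z x := fun x y z => rfl
  have hσ : ∀ y, omegaTrace φ C y = -2 * (n - 2) * σ y := by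
    intro y; simp only [σ, LinearMap.smul_apply, trL_apply, smul_eq_mul]; field_simp
  have hβ : ∀ y, omegaTrace φ (rot T) y = 2 * σ y - (n + 1) * β y := by
    intro y
    simp only [β, LinearMap.smul_apply, LinearMap.sub_apply, trL_apply, smul_eq_mul, nsmul_eq_mul]
    field_simp
    simp
    ring
  have hα : ∀ y, α y = σ y - β y := fun y => rfl
  have hS : ∀ x y z, S x y z = (1 / 6) * (T x y z + T z x y + T y z x
      - 2 * (σ x * Ω y z + σ z * Ω x y + σ y * Ω z x)) := by
    intro x y z
    simp only [S, LinearMap.smul_apply, LinearMap.add_apply, hC, rot_apply, el_apply, smul_eq_mul]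
    ring
  have hH : ∀ x y z, H x y z = 2 * (α z * Ω x y) + β y * Ω z x + β x * Ω y z + 2 * S x y z
      - T z x y := by
    intro x y z
    simp only [H, LinearMap.smul_apply, LinearMap.add_apply, rot_apply, el_apply, smul_eq_mul]
    ring
  have trS : ∀ y, omegaTrace φ S y = 0 := by
    intro y
    simp only [S, tr_smul, tr_add, hσ, e0, e1, e2]
    ring
  refine ⟨(α, β, H, S), ⟨?_, ?_, ?_, ?_, ?_, ?_, ?_⟩, ?_⟩
  · intro x y z
    simp only [hH, hS]
    rw [hT z x y, hT x y z, hT y z x, hs x y, hs z x, hs y z]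
    ring
  · intro x y z
    simp only [hH, hS, hα]
    ring
  · intro y
    simp only [H, tr_smul, tr_add, trS, hβ, e0, e1, e2, hα]
    ring
  · intro x y z
    simp only [hS]
    rw [hT z x y, hT x y z, hT y z x, hs x y, hs z x, hs y z]
    ring
  · intro x y z
    simp only [hS]
    rw [hT z x y, hT x y z, hT y z x, hs x y, hs z x, hs y z]
    ring
  · exact trS
  · intro a b c
    simp only [hH]
    rw [hs c a]
    ring
  · rintro ⟨α', β', H', S'⟩ ⟨q1, q2, q3, q4, q5, q6, q7⟩
    simp only at q1 q2 q3 q4 q5 q6 q7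
    have hR : rot T = (2 : ℝ) • rot (el Ω α') + rot (rot (el Ω β')) + el Ω β' + (2 : ℝ) • S'
        + (-1 : ℝ) • H' := by
      ext x y z
      simp only [LinearMap.smul_apply, LinearMap.add_apply, rot_apply, el_apply, smul_eq_mul, q7]
      rw [hs z y]
      ring
    have hCC : C = (2 : ℝ) • (el Ω (α' + β') + rot (el Ω (α' + β')) + rot (rot (el Ω (α' + β'))))
        + (6 : ℝ) • S' := by
      ext x y z
      simp only [hC, LinearMap.smul_apply, LinearMap.add_apply, rot_apply, el_apply, smul_eq_mul,
        q7]
      have s1 : S' y z x = S' x y z := by rw [q5 y z x, q4 y x z, neg_neg]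
      have s2 : S' z x y = S' x y z := by rw [q4 z x y, q5 x z y, neg_neg]
      have := q2 x y z
      rw [s1, s2, hs x z, hs y x, hs z y]
      linarith
    have hσ' : ∀ y, α' y + β' y = σ y := by
      intro y
      have h := hσ y
      rw [hCC] at h
      simp only [tr_smul, tr_add, e0, e1, e2, q6, LinearMap.add_apply] at h
      apply mul_left_cancel₀ h2
      linarith
    have hβ' : β' = β := by
      ext y
      have h := hβ y
      rw [hR] at h
      simp only [tr_smul, tr_add, e0, e1, e2, q6, q3] at h
      apply mul_left_cancel₀ h1
      have := hσ' y
      linarith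
    have hα' : α' = α := by
      ext y
      rw [hα, ← hσ' y, hβ']; ring
    have hS' : S' = S := by
      ext x y z
      have h := congrArg (fun F => F x y z) hCC
      simp only [hC, LinearMap.smul_apply, LinearMap.add_apply, rot_apply, el_apply, smul_eq_mul,
        hσ'] at h
      rw [hS, h]
      ring
    have hH' : H' = H := by
      ext x y z
      rw [hH, q7 z x y, hα', hβ', hS', hs y z]
      ring
    rw [hα', hβ', hS', hH']
end

section
/- Let V be a finite-dimensional real symplectic vector space of dimension n ≥ 6 with symplectic form Ω. Let T be a trilinear form antisymmetric in its last two arguments with decomposition data (α, β, H, S), i.e. T(a,b,c) = 2α(a)Ω(b,c) + Ω(a,b)β(c) − Ω(a,c)β(b) − H(b,c,a) + 2S(b,c,a). Given Υ ∈ V*, define E(a) ∈ End(V) by E(a)(b) := Υ(a)·b + Υ(b)·a, and set T̄(a,b,c) := T(a,b,c) − Ω(E(a)b, c) − Ω(b, E(a)c) + (2/n)·tr(E(a))·Ω(b,c) (note tr E(a) = (n+1)Υ(a)). Then T̄ is again antisymmetric in its last two arguments, T̄(a,b,c) − T(a,b,c) = (2/n)Υ(a)Ω(b,c) + Ω(a,b)Υ(c)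 − Ω(a,c)Υ(b), and T̄ has decomposition data (α + (1/n)Υ, β + Υ, H, S). (This is the transformation rule of Section 2: under a projective change of connection by Υ, the components transform as ᾱ = α + Υ/n and β̄ = β + Υ, while H and S are unchanged.) -/
/-- The transformation rule of Section 2: under a projective change of connection given by
`Υ ∈ V*`, i.e. `E(a)(b) = Υ(a)b + Υ(b)a`, the modified trilinear form
`T̄(a,b,c) = T(a,b,c) − Ω(E(a)b,c) − Ω(b,E(a)c) + (2/n)tr(E(a))Ω(b,c)` is again
antisymmetric in the last two slots, differs from `T` by
`(2/n)Υ(a)Ω(b,c) + Ω(a,b)Υ(c) − Ω(a,c)Υ(b)`, and has decomposition data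
`(α + Υ/n, β + Υ, H, S)`; moreover `tr E(a) = (n+1)Υ(a)`. -/
theorem stmt3 {V : Type*} [AddCommGroup V] [Module ℝ V] [FiniteDimensional ℝ V]
    (Ω : V →ₗ[ℝ] V →ₗ[ℝ] ℝ)
    (halt : ∀ x : V, Ω x x = 0)
    (hnd : ∀ x : V, (∀ y : V, Ω x y = 0) → x = 0)
    (φ : V ≃ₗ[ℝ] Module.Dual ℝ V) (hφ : ∀ w v : V, φ w v = Ω w v)
    (hdim : 6 ≤ Module.finrank ℝ V)
    (T H S : V →ₗ[ℝ] V →ₗ[ℝ] V →ₗ[ℝ] ℝ)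
    (α β Υ : Module.Dual ℝ V)
    (hT : ∀ a b c : V, T a b c = - T a c b)
    (hH1 : ∀ x y z : V, H x y z = - H y x z)
    (hH2 : ∀ x y z : V, H x y z + H y z x + H z x y = 0)
    (hH3 : ∀ y : V, omegaTrace φ H y = 0)
    (hS1 : ∀ x y z : V, S x y z = - S y x z)
    (hS2 : ∀ x y z : V, S x y z = - S x z y)
    (hS3 : ∀ y : V, omegaTrace φ S y = 0)
    (hdecomp : ∀ a b c : V, T a b c =
      2 * α a * Ω b c + Ω a b * β c - Ω a c * β b - H b c a + 2 * S b c a) :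
    let n : ℝ := (Module.finrank ℝ V : ℝ)
    let E : V → (V →ₗ[ℝ] V) := fun a => Υ a • LinearMap.id + Υ.smulRight a
    let Tbar : V → V → V → ℝ := fun a b c =>
      T a b c - Ω ((E a) b) c - Ω b ((E a) c)
        + (2 / n) * (LinearMap.trace ℝ V (E a)) * Ω b c
    (∀ a : V, LinearMap.trace ℝ V (E a) = (n + 1) * Υ a) ∧
    (∀ a b c : V, Tbar a b c = - Tbar a c b) ∧
    (∀ a b c : V, Tbar a b c - T a b c =
      (2 / n) * Υ a * Ω b c + Ω a b * Υ c - Ω a c * Υ b) ∧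
    (∀ a b c : V, Tbar a b c =
      2 * (α a + Υ a / n) * Ω b c + Ω a b * (β c + Υ c) - Ω a c * (β b + Υ b)
        - H b c a + 2 * S b c a) := by
  intro n E Tbar
  have hn : n ≠ 0 := by
    have h : Module.finrank ℝ V ≠ 0 := by omega
    exact Nat.cast_ne_zero.mpr h
  have hskew : ∀ x y : V, Ω x y = - Ω y x := by
    intro x y
    have h := halt (x + y)
    simp only [map_add, LinearMap.add_apply, halt] at h
    linarith
  have htr : ∀ a : V, LinearMap.trace ℝ V (E a) = (n + 1) * Υ a := by
    intro a
    simp only [E, n, map_add, map_smul, LinearMap.trace_id, LinearMap.trace_smulRight, smul_eq_mul]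
    ring
  have hdiff : ∀ a b c : V, Tbar a b c - T a b c =
      (2 / n) * Υ a * Ω b c + Ω a b * Υ c - Ω a c * Υ b := by
    intro a b c
    simp only [Tbar, htr]
    simp only [E, LinearMap.add_apply, LinearMap.smul_apply, LinearMap.id_apply,
      LinearMap.smulRight_apply, map_add, map_smul, smul_eq_mul]
    rw [hskew b a]
    field_simp
    ring
  refine ⟨htr, ?_, hdiff, ?_⟩
  · intro a b c
    have h1 := hdiff a b c
    have h2 := hdiff a c b
    rw [hskew c b] at h2
    have h3 := hT a b c
    linarith
  · intro a b c
    have h1 := hdiff a b c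
    rw [hdecomp a b c] at h1
    have h2 : 2 / n * Υ a * Ω b c = 2 * (Υ a / n) * Ω b c := by ring
    linarith
end

section
/- Let V be a finite-dimensional real symplectic vector space of dimension n ≥ 6 with symplectic form Ω, and let T be a trilinear form antisymmetric in its last two arguments with decomposition data (α, β, H, S). Then for all a, b, c ∈ V the cyclic sum satisfies T(a,b,c) + T(b,c,a) + T(c,a,b) = 6·S(a,b,c) + 2[(α+β)(a)·Ω(b,c) + (α+β)(b)·Ω(c,a) + (α+β)(c)·Ω(a,b)]. In particular, the trace-free part of the cyclic sum (the exterior derivative dJ in the paper) equals 6S. (This is the computational content of Lemma 3.1(1): the component S is the structural torsion of the ACS-structure, i.e. the obstruction to ℓ admitting closed local sections.) -/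
/-- The computational content of Lemma 3.1(1): for a trilinear form `T` with decomposition
data `(α, β, H, S)`, the cyclic sum satisfies
`T(a,b,c) + T(b,c,a) + T(c,a,b) = 6S(a,b,c) + 2[(α+β)(a)Ω(b,c) + (α+β)(b)Ω(c,a) + (α+β)(c)Ω(a,b)]`,
so its trace-free part (the exterior derivative `dJ`) equals `6S`. -/
theorem stmt4 {V : Type*} [AddCommGroup V] [Module ℝ V] [FiniteDimensional ℝ V]
    (Ω : V →ₗ[ℝ] V →ₗ[ℝ] ℝ)
    (halt : ∀ x : V, Ω x x = 0)
    (hnd : ∀ x : V, (∀ y : V, Ω x y = 0) → x = 0)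
    (φ : V ≃ₗ[ℝ] Module.Dual ℝ V) (hφ : ∀ w v : V, φ w v = Ω w v)
    (hdim : 6 ≤ Module.finrank ℝ V)
    (T H S : V →ₗ[ℝ] V →ₗ[ℝ] V →ₗ[ℝ] ℝ)
    (α β : Module.Dual ℝ V)
    (hT : ∀ a b c : V, T a b c = - T a c b)
    (hH1 : ∀ x y z : V, H x y z = - H y x z)
    (hH2 : ∀ x y z : V, H x y z + H y z x + H z x y = 0)
    (hH3 : ∀ y : V, omegaTrace φ H y = 0)
    (hS1 : ∀ x y z : V, S x y z = - S y x z)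
    (hS2 : ∀ x y z : V, S x y z = - S x z y)
    (hS3 : ∀ y : V, omegaTrace φ S y = 0)
    (hdecomp : ∀ a b c : V, T a b c =
      2 * α a * Ω b c + Ω a b * β c - Ω a c * β b - H b c a + 2 * S b c a) :
    ∀ a b c : V,
      T a b c + T b c a + T c a b =
        6 * S a b c +
          2 * ((α a + β a) * Ω b c + (α b + β b) * Ω c a + (α c + β c) * Ω a b) := by
  intro a b c
  have hanti : ∀ x y : V, Ω x y = - Ω y x := by
    intro x y
    have h := halt (x + y)
    simp only [map_add, LinearMap.add_apply, halt] at h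
    linarith
  have e1 : S b c a = S a b c := by
    rw [hS2 b c a, hS1 b a c, neg_neg]
  have e2 : S c a b = S a b c := by
    rw [hS1 c a b, hS2 a c b, neg_neg]
  rw [hdecomp a b c, hdecomp b c a, hdecomp c a b, e1, e2,
    hanti a c, hanti b a, hanti c b]
  linear_combination - hH2 a b c
end
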